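/- Every homeomorphism h of the Golomb space maps the set of primes onto itself, and satisfies Π_{h(x)} = h(Π_x) for every positive integer x, where Π_x denotes the set of prime divisors of x. -/

import Mathlib

/-- The base of the Golomb topology: arithmetic progressions `{a + b*n : n ≥ 0}`
with coprime `a, b ≥ 1`, viewed inside the positive integers. -/
def golombBasis : Set (Set ℕ+) :=
  {S | ∃ a b : ℕ, 1 ≤ a ∧ 1 ≤ b ∧ Nat.Coprime a b ∧
    S = {x : ℕ+ | ∃ n : ℕ, (x : ℕ) = a + b * n}}

/-- The Golomb (relatively prime integer) topology on `ℕ+`. -/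
instance golombTopology : TopologicalSpace ℕ+ :=
  TopologicalSpace.generateFrom golombBasis

open Filter Topology

def gProg (x b : ℕ) : Set ℕ+ := {z : ℕ+ | ∃ n : ℕ, (z : ℕ) = x + b * n}

def gK (x b : ℕ) : Set ℕ+ := {z : ℕ+ | ∀ d : ℕ, d ∣ b → Nat.Coprime d z → (z : ℕ) ≡ x [MOD d]}

lemma gOpen (s : Set ℕ+) (hs : IsOpen s) :
    ∀ x ∈ s, ∃ b : ℕ, (0 < b ∧ Nat.Coprime x b) ∧ gProg x b ⊆ s := by
  have hs' : TopologicalSpace.GenerateOpen golombBasis s := hs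
  clear hs
  induction hs' with
  | basic s hs =>
    obtain ⟨a, b, ha, hb, hab, rfl⟩ := hs
    rintro x ⟨n, hn⟩
    refine ⟨b, ⟨hb, ?_⟩, ?_⟩
    · rw [hn]; simpa using hab
    · rintro z ⟨m, hm⟩
      exact ⟨n + m, by rw [hm, hn]; ring⟩
  | univ => exact fun x _ => ⟨1, ⟨one_pos, Nat.coprime_one_right _⟩, Set.subset_univ _⟩
  | inter s t _ _ ihs iht =>
    rintro x ⟨hxs, hxt⟩
    obtain ⟨b, ⟨hb, hxb⟩, hbs⟩ := ihs x hxs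
    obtain ⟨c, ⟨hc, hxc⟩, hct⟩ := iht x hxt
    refine ⟨b * c, ⟨Nat.mul_pos hb hc, hxb.mul_right hxc⟩, ?_⟩
    rintro z ⟨m, hm⟩
    exact ⟨hbs ⟨c * m, by rw [hm]; ring⟩, hct ⟨b * m, by rw [hm]; ring⟩⟩
  | sUnion S _ ih =>
    rintro x ⟨s, hs, hx⟩
    obtain ⟨b, hb, hbs⟩ := ih s hs x hx
    exact ⟨b, hb, hbs.trans (Set.subset_sUnion_of_mem hs)⟩

lemma gProg_open (x b : ℕ) (hx : 0 < x) (hb : 0 < b) (h : Nat.Coprime x b) :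
    IsOpen (gProg x b) :=
  TopologicalSpace.GenerateOpen.basic _ ⟨x, b, hx, hb, h, rfl⟩

lemma gBasis (x : ℕ+) :
    (𝓝 x).HasBasis (fun b : ℕ => 0 < b ∧ Nat.Coprime x b) (fun b => gProg x b) := by
  constructor
  intro t
  rw [mem_nhds_iff]
  constructor
  · rintro ⟨s, hst, hs, hx⟩
    obtain ⟨b, hb, hbs⟩ := gOpen s hs x hx
    exact ⟨b, hb, hbs.trans hst⟩
  · rintro ⟨b, hb, hbt⟩
    exact ⟨_, hbt, gProg_open x b x.pos hb.1 hb.2, 0, by simp⟩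

lemma gClosure (x : ℕ) (b : ℕ) (hb : 0 < b) : closure (gProg x b) = gK x b := by
  ext z
  rw [mem_closure_iff_nhds_basis (gBasis z)]
  constructor
  · intro H d hd hdz
    obtain ⟨w, ⟨n, hn⟩, ⟨m, hm⟩⟩ := H d ⟨Nat.pos_of_dvd_of_pos hd hb, hdz.symm⟩
    obtain ⟨e, rfl⟩ := hd
    have h1 : (w : ℕ) ≡ x [MOD d] := by
      rw [hn]; unfold Nat.ModEq; rw [mul_assoc]; simp
    have h2 : (w : ℕ) ≡ z [MOD d] := by
      rw [hm]; unfold Nat.ModEq; simp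
    exact h2.symm.trans h1
  · rintro H c ⟨hc, hzc⟩
    have h1 := H (Nat.gcd b c) (Nat.gcd_dvd_left _ _)
      ((hzc.coprime_dvd_right (Nat.gcd_dvd_right _ _)).symm)
    obtain ⟨w, hwb, hwc⟩ := Nat.chineseRemainder' h1.symm
    have hbig : z + x ≤ b * c * (z + x) := Nat.le_mul_of_pos_left _ (Nat.mul_pos hb hc)
    have hpos : 0 < w + b * c * (z + x) := by have := z.pos; omega
    refine ⟨⟨w + b * c * (z + x), hpos⟩, ?_, ?_⟩
    · have : x ≡ w + b * c * (z + x) [MOD b] := by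
        refine hwb.symm.trans ?_
        unfold Nat.ModEq; rw [mul_assoc]; simp
      obtain ⟨n, hn⟩ := (Nat.modEq_iff_dvd' (by omega)).1 this
      exact ⟨n, by simp only [PNat.mk_coe]; omega⟩
    · have : (z : ℕ) ≡ w + b * c * (z + x) [MOD c] := by
        refine hwc.symm.trans ?_
        unfold Nat.ModEq; rw [mul_comm b c, mul_assoc]; simp
      obtain ⟨n, hn⟩ := (Nat.modEq_iff_dvd' (by omega)).1 this
      exact ⟨n, by simp only [PNat.mk_coe]; omega⟩

def gG (x : ℕ+) : Filter ℕ+ := (𝓝 x).lift' closure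

lemma gG_basis (x : ℕ+) :
    (gG x).HasBasis (fun b : ℕ => 0 < b ∧ Nat.Coprime x b) (fun b => gK x b) := by
  have h := (gBasis x).lift' (monotone_closure ℕ+)
  exact h.congr (fun _ => Iff.rfl) (fun b hb => gClosure x b hb.1)

lemma gG_map (h : ℕ+ ≃ₜ ℕ+) (x : ℕ+) : Filter.map h (gG x) = gG (h x) := by
  unfold gG
  rw [map_lift'_eq (monotone_closure _), ← h.map_nhds_eq, map_lift'_eq2 (monotone_closure _)]
  congr 1
  ext s : 1
  exact h.image_closure s

def gR (x y x' y' : ℕ+) : Prop := gG x' ⊓ gG y' ≤ gG x ⊓ gG y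

lemma gR_map (h : ℕ+ ≃ₜ ℕ+) (x y x' y' : ℕ+) :
    gR (h x) (h y) (h x') (h y') ↔ gR x y x' y' := by
  unfold gR
  simp only [← gG_map, ← Filter.map_inf h.injective]
  exact Filter.map_le_map_iff h.injective

lemma gR_iff (x y x' y' : ℕ+) : gR x y x' y' ↔
    ∀ b c : ℕ, 0 < b → 0 < c → Nat.Coprime x b → Nat.Coprime y c →
    ∃ b' c' : ℕ, 0 < b' ∧ 0 < c' ∧ Nat.Coprime x' b' ∧ Nat.Coprime y' c' ∧
      gK x' b' ∩ gK y' c' ⊆ gK x b ∩ gK y c := by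
  unfold gR
  rw [((gG_basis x').inf (gG_basis y')).le_basis_iff ((gG_basis x).inf (gG_basis y))]
  constructor
  · intro H b c hb hc hxb hyc
    obtain ⟨⟨b', c'⟩, ⟨⟨h1, h2⟩, h3, h4⟩, h5⟩ := @H (b, c) ⟨⟨hb, hxb⟩, hc, hyc⟩
    exact ⟨b', c', h1, h3, h2, h4, h5⟩
  · rintro H ⟨b, c⟩ ⟨⟨hb, hxb⟩, hc, hyc⟩
    obtain ⟨b', c', h1, h3, h2, h4, h5⟩ := H b c hb hc hxb hyc
    exact ⟨(b', c'), ⟨⟨h1, h2⟩, h3, h4⟩, h5⟩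

/-- no congruence `y ≡ 1` modulo a large prime power -/
lemma gNe (p y k : ℕ) (hp : p.Prime) (hy : 2 ≤ y) (hk : y ≤ k) : ¬ y ≡ 1 [MOD p ^ k] := by
  intro h
  have h1 := (Nat.modEq_iff_dvd' (by omega)).1 h.symm
  have h2 := Nat.le_of_dvd (by omega) h1
  have h3 : k < p ^ k := Nat.lt_pow_self hp.one_lt
  omega

lemma gR_of_supp (x y : ℕ+) (hy : 2 ≤ (y : ℕ))
    (H : ∀ p : ℕ, p.Prime → p ∣ y → p ∣ x) : gR 1 x 1 y := by
  rw [gR_iff]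
  intro b c hb hc _ hxc
  have hyc : Nat.Coprime y c := by
    refine Nat.Coprime.symm (Nat.Coprime.symm (Nat.coprime_of_dvd ?_))
    intro p hp h1 h2
    exact Nat.not_coprime_of_dvd_of_dvd hp.one_lt (H p hp h1) h2 hxc
  refine ⟨b * c ^ (y : ℕ), c ^ (y : ℕ), by positivity, by positivity, by simp,
    hyc.pow_right _, ?_⟩
  rintro z ⟨h1, h2⟩
  refine ⟨fun d hd hdz => h1 d (hd.mul_right _) hdz, ?_⟩
  intro d hd hdz
  by_cases hd1 : d = 1
  · subst hd1; exact Nat.modEq_one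
  exfalso
  obtain ⟨p, hp, hpd⟩ := Nat.exists_prime_and_dvd hd1
  have hpz : Nat.Coprime (p ^ (y : ℕ)) z := (hdz.coprime_dvd_left hpd).pow_left _
  have hpc : p ^ (y : ℕ) ∣ c ^ (y : ℕ) := pow_dvd_pow_of_dvd (hpd.trans hd) _
  have e1 := h1 _ (hpc.mul_left b) hpz
  have e2 := h2 _ hpc hpz
  exact gNe p y y hp hy le_rfl (e2.symm.trans e1)

/-- the basic construction of a point -/
lemma gPoint (p v t n : ℕ) (hp : p.Prime) (ht : 0 < t) (hn : 0 < n) (htp : ¬ p ∣ t)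
    (hnp : ¬ p ∣ n) :
    ∃ z : ℕ+, n ∣ z ∧ (z : ℕ) ≡ t [MOD p ^ v] ∧ ¬ p ∣ (z : ℕ) := by
  have hpos : 0 < t * n ^ Nat.totient (p ^ v) := by positivity
  refine ⟨⟨_, hpos⟩, ?_, ?_, ?_⟩
  · exact (dvd_pow_self n (Nat.totient_pos.2 (pow_pos hp.pos v)).ne').mul_left _
  · have : n ^ Nat.totient (p ^ v) ≡ 1 [MOD p ^ v] :=
      Nat.ModEq.pow_totient (((hp.coprime_iff_not_dvd.2 hnp).symm).pow_right _)
    simpa using this.mul_left t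
  · intro h
    rcases hp.dvd_mul.1 h with h | h
    · exact htp h
    · exact hnp (hp.dvd_of_dvd_pow h)

lemma gCop_one {d n z : ℕ} (h1 : d ∣ n) (h2 : n ∣ z) (h3 : Nat.Coprime d z) : d = 1 :=
  Nat.Coprime.eq_one_of_dvd h3 (h1.trans h2)

lemma gSupp_of_R (x y : ℕ+) (hx : 2 ≤ (x : ℕ)) (hR : gR 1 x 1 y) :
    ∀ p : ℕ, p.Prime → p ∣ y → p ∣ x := by
  intro p hp hpy
  by_contra hpx
  rw [gR_iff] at hR
  obtain ⟨b, c, hb, hc, -, hyc, hsub⟩ := hR (p ^ (x : ℕ)) (p ^ (x : ℕ)) (pow_pos hp.pos _)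
    (pow_pos hp.pos _) (by simp) (((hp.coprime_iff_not_dvd.2 hpx).symm).pow_right _)
  obtain ⟨v, m, hpm, rfl⟩ := Nat.exists_eq_pow_mul_and_not_dvd hb.ne' p hp.ne_one
  have hpc : ¬ p ∣ c := fun h => Nat.not_coprime_of_dvd_of_dvd hp.one_lt hpy h hyc
  have hm : 0 < m := Nat.pos_of_ne_zero (by rintro rfl; simp at hpm)
  obtain ⟨z, hz1, hz2, hz3⟩ := gPoint p v 1 (m * c) hp one_pos (Nat.mul_pos hm hc)
    (by simpa using hp.ne_one) (by rw [hp.dvd_mul]; tauto)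
  have hz : z ∈ gK ((1 : ℕ+) : ℕ) (p ^ v * m) ∩ gK y c := by
    constructor
    · intro d hd hdz
      have : Nat.Coprime d m := hdz.coprime_dvd_right ((Dvd.intro _ rfl).trans hz1)
      exact hz2.of_dvd (this.dvd_of_dvd_mul_right hd)
    · intro d hd hdz
      rw [gCop_one hd ((Dvd.intro_left _ rfl).trans hz1) hdz]
      exact Nat.modEq_one
  have hzc : Nat.Coprime (p ^ (x : ℕ)) z := (hp.coprime_iff_not_dvd.2 hz3).pow_left _
  have e1 := (hsub hz).1 _ dvd_rfl hzc
  have e2 := (hsub hz).2 _ dvd_rfl hzc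
  exact gNe p x x hp hx le_rfl (e2.symm.trans e1)

lemma gOne_of_R (x y : ℕ+) (hx : 2 ≤ (x : ℕ)) (hR : gR 1 x x y) : y = 1 := by
  by_contra hy
  have hy2 : 2 ≤ (y : ℕ) := by
    have := y.pos
    have : (y : ℕ) ≠ 1 := fun h => hy (PNat.coe_eq_one_iff.1 h)
    omega
  obtain ⟨p, hp, hpx⟩ := Nat.exists_prime_and_dvd (show (x : ℕ) ≠ 1 by omega)
  rw [gR_iff] at hR
  obtain ⟨b, c, hb, hc, hxb, hyc, hsub⟩ := hR (p ^ (y + 2 : ℕ)) 1 (pow_pos hp.pos _)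
    one_pos (by simp) (by simp)
  have hpb : ¬ p ∣ b := fun h => Nat.not_coprime_of_dvd_of_dvd hp.one_lt hpx h hxb
  obtain ⟨v, m, hpm, rfl⟩ := Nat.exists_eq_pow_mul_and_not_dvd hc.ne' p hp.ne_one
  have hm : 0 < m := Nat.pos_of_ne_zero (by rintro rfl; simp at hpm)
  obtain ⟨t, ht, htp, htv, ht1⟩ : ∃ t : ℕ, 0 < t ∧ ¬ p ∣ t ∧ t ≡ y [MOD p ^ v] ∧
      ¬ t ≡ 1 [MOD p ^ (y + 2 : ℕ)] := by
    by_cases hpy : p ∣ y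
    · have hv : v = 0 := by
        by_contra hv
        exact Nat.not_coprime_of_dvd_of_dvd hp.one_lt hpy
          ((dvd_pow_self p hv).mul_right m) hyc
      refine ⟨1 + p, by omega, ?_, ?_, ?_⟩
      · rw [Nat.dvd_add_left dvd_rfl]; simpa using hp.ne_one
      · rw [hv, pow_zero]; exact Nat.modEq_one
      · intro h
        have h1 := (Nat.modEq_iff_dvd' (by omega)).1 h.symm
        have h2 := Nat.le_of_dvd (by have := hp.pos; omega) h1
        have h3 : p ^ 1 < p ^ (y + 2 : ℕ) := Nat.pow_lt_pow_right hp.one_lt (by omega)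
        rw [pow_one] at h3
        omega
    · exact ⟨y, y.pos, hpy, rfl, gNe p y _ hp hy2 (by omega)⟩
  obtain ⟨z, hz1, hz2, hz3⟩ := gPoint p (v + (y + 2)) t (b * m) hp ht (Nat.mul_pos hb hm)
    htp (by rw [hp.dvd_mul]; tauto)
  have hz : z ∈ gK x b ∩ gK y (p ^ v * m) := by
    constructor
    · intro d hd hdz
      rw [gCop_one hd ((Dvd.intro _ rfl).trans hz1) hdz]
      exact Nat.modEq_one
    · intro d hd hdz
      have : Nat.Coprime d m := hdz.coprime_dvd_right ((Dvd.intro_left _ rfl).trans hz1)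
      have h2 := this.dvd_of_dvd_mul_right hd
      exact ((hz2.of_dvd (pow_dvd_pow p (by omega))).trans htv).of_dvd h2
  have hzc : Nat.Coprime (p ^ (y + 2 : ℕ)) z := (hp.coprime_iff_not_dvd.2 hz3).pow_left _
  have e1 := (hsub hz).1 _ dvd_rfl hzc
  exact ht1 ((hz2.of_dvd (pow_dvd_pow p (by omega))).symm.trans e1)

lemma gTwo_le (x : ℕ+) (hx : x ≠ 1) : 2 ≤ (x : ℕ) := by
  have := x.pos
  have : (x : ℕ) ≠ 1 := fun h => hx (PNat.coe_eq_one_iff.1 h)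
  omega

lemma gHomeo_one (h : ℕ+ ≃ₜ ℕ+) : h 1 = 1 := by
  by_contra hne
  set y := h.symm 1 with hy
  have hhy : h y = 1 := by simp [hy]
  have hy1 : y ≠ 1 := by rintro h1; rw [h1] at hhy; exact hne hhy
  have hy2 := gTwo_le y hy1
  have hR : gR 1 y 1 (y ^ 2) := by
    apply gR_of_supp
    · rw [PNat.pow_coe]; nlinarith
    · intro p hp hpy
      rw [PNat.pow_coe] at hpy
      exact hp.dvd_of_dvd_pow hpy
  have hR2 := (gR_map h _ _ _ _).2 hR
  rw [hhy] at hR2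
  have hR3 : gR 1 (h 1) (h 1) (h (y ^ 2)) := by
    unfold gR at hR2 ⊢
    rwa [inf_comm (gG 1)]
  have h4 := gOne_of_R _ _ (gTwo_le _ hne) hR3
  have h5 : y ^ 2 = y := h.injective (h4.trans hhy.symm)
  have h6 := congrArg PNat.val h5
  rw [PNat.pow_coe] at h6
  nlinarith

def gSupp (y x : ℕ+) : Prop := ∀ p : ℕ, p.Prime → p ∣ (y : ℕ) → p ∣ (x : ℕ)

lemma gSupp_map1 (h : ℕ+ ≃ₜ ℕ+) (x y : ℕ+) (H : gSupp y x) : gSupp (h y) (h x) := by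
  have h1 := gHomeo_one h
  by_cases hy : y = 1
  · subst hy
    rw [h1]
    intro p hp hp1
    exact absurd (Nat.dvd_one.1 hp1) hp.ne_one
  have hy2 := gTwo_le y hy
  have hx : x ≠ 1 := by
    rintro rfl
    obtain ⟨p, hp, hpx⟩ := Nat.exists_prime_and_dvd (show (y : ℕ) ≠ 1 by omega)
    exact absurd (Nat.dvd_one.1 (H p hp hpx)) hp.ne_one
  have hhx : h x ≠ 1 := fun e => hx (h.injective (e.trans h1.symm))
  have hR := (gR_map h _ _ _ _).2 (gR_of_supp x y hy2 H)
  rw [h1] at hR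
  exact gSupp_of_R _ _ (gTwo_le _ hhx) hR

lemma gSupp_map (h : ℕ+ ≃ₜ ℕ+) (x y : ℕ+) : gSupp (h y) (h x) ↔ gSupp y x := by
  refine ⟨fun H => ?_, gSupp_map1 h x y⟩
  simpa using gSupp_map1 h.symm _ _ H

lemma gMod_of_primes (m : ℕ) (n : ℕ) (hn : n ≠ 0)
    (H : ∀ q : ℕ, q.Prime → q ∣ n → q ≡ 1 [MOD m]) : n ≡ 1 [MOD m] := by
  induction n using Nat.recOnMul with
  | zero => exact absurd rfl hn
  | one => rfl
  | prime p hp => exact H p hp dvd_rfl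
  | mul a b iha ihb =>
    have ha := iha (by rintro rfl; simp at hn) fun q hq hqa => H q hq (hqa.mul_right _)
    have hb := ihb (by rintro rfl; simp at hn) fun q hq hqa => H q hq (hqa.mul_left _)
    simpa using ha.mul hb

lemma gPow_of_supp (p r : ℕ+) (hr : (r : ℕ).Prime) (H : gSupp p r) :
    ∃ a : ℕ, (p : ℕ) = (r : ℕ) ^ a :=
  ⟨_, Nat.eq_prime_pow_of_unique_prime_dvd p.ne_zero fun hd hdp =>
    (Nat.prime_dvd_prime_iff_eq hd hr).1 (H _ hd hdp)⟩

lemma gPrime (h : ℕ+ ≃ₜ ℕ+) (p : ℕ+) (hp : (p : ℕ).Prime) : ((h p : ℕ+) : ℕ).Prime := by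
  have h1 := gHomeo_one h
  have hp1 : p ≠ 1 := by rintro rfl; exact Nat.not_prime_one hp
  have hhp : h p ≠ 1 := fun e => hp1 (h.injective (e.trans h1.symm))
  obtain ⟨r0, hr0, hrp⟩ := Nat.exists_prime_and_dvd
    (show ((h p : ℕ+) : ℕ) ≠ 1 by have := gTwo_le _ hhp; omega)
  obtain ⟨r, rfl⟩ : ∃ r : ℕ+, (r : ℕ) = r0 := ⟨⟨r0, hr0.pos⟩, rfl⟩
  obtain ⟨w, rfl⟩ := h.surjective r
  have hw : gSupp w p := by
    rw [← gSupp_map h]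
    intro q hq hqr
    rw [(Nat.prime_dvd_prime_iff_eq hq hr0).1 hqr]
    exact hrp
  have hw1 : w ≠ 1 := by rintro rfl; rw [h1] at hr0; exact Nat.not_prime_one hr0
  obtain ⟨n, hn⟩ := gPow_of_supp w p hp hw
  have hn0 : n ≠ 0 := by
    rintro rfl
    exact hw1 (PNat.coe_eq_one_iff.1 (by simpa using hn))
  have hpw : gSupp p w := by
    intro q hq hqp
    rw [hn]
    exact hqp.trans (dvd_pow_self _ hn0)
  obtain ⟨a, ha⟩ := gPow_of_supp (h p) (h w) hr0 ((gSupp_map h _ _).2 hpw)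
  have ha0 : a ≠ 0 := by
    rintro rfl
    exact hhp (PNat.coe_eq_one_iff.1 (by simpa using ha))
  by_cases ha1 : a = 1
  · rw [ha, ha1, pow_one]; exact hr0
  exfalso
  set r : ℕ := ((h w : ℕ+) : ℕ) with hr
  have hr2 : r ^ 2 ≤ r ^ a := Nat.pow_le_pow_right hr0.pos (by omega)
  have hrt := hr0.two_le
  obtain ⟨m, hm⟩ : ∃ m, r ^ a = m + 1 := ⟨r ^ a - 1, (Nat.succ_pred_eq_of_pos (pow_pos hr0.pos a)).symm⟩
  have hrm : r ≤ m := by nlinarith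
  have hm0 : 0 < m := by omega
  have hcop : Nat.Coprime r m := by
    have : Nat.Coprime (r ^ a) m := by rw [hm]; simp
    exact this.coprime_dvd_left (dvd_pow_self _ ha0)
  let D' : Set ℕ+ := {y | ∀ q : ℕ, q.Prime → q ∣ (y : ℕ) → q ≡ 1 [MOD m]}
  have c1 : h p ∈ closure D' := by
    rw [mem_closure_iff_nhds_basis (gBasis _)]
    rintro b ⟨hb, hpb⟩
    have hcop2 : Nat.Coprime ((h p : ℕ+) : ℕ) (b * m) := by
      refine hpb.mul_right ?_
      rw [ha]; exact hcop.pow_left _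
    obtain ⟨l, hl, hlp, hlm⟩ := Nat.forall_exists_prime_gt_and_modEq ((h p : ℕ+) : ℕ)
      (Nat.mul_pos hb hm0).ne' hcop2
    refine ⟨⟨l, hlp.pos⟩, ?_, ?_⟩
    · intro q hq hql
      rw [(Nat.prime_dvd_prime_iff_eq hq hlp).1 hql]
      refine (hlm.of_mul_left b).trans ?_
      rw [ha, hm]; unfold Nat.ModEq; simp
    · obtain ⟨k, hk⟩ := (Nat.modEq_iff_dvd' hl.le).1 (hlm.of_mul_right m).symm
      exact ⟨k, by simp only [PNat.mk_coe]; omega⟩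
  have c2 : p ∈ closure (h ⁻¹' D') := by
    rw [← h.preimage_closure]; exact c1
  have c3 : w ∈ closure (h ⁻¹' D') := by
    rw [mem_closure_iff_nhds_basis (gBasis _)] at c2 ⊢
    rintro b ⟨hb, hwb⟩
    have hpb : Nat.Coprime p b := by
      rw [hn] at hwb
      exact hwb.coprime_dvd_left (dvd_pow_self _ hn0)
    obtain ⟨y, hy, k, hk⟩ := c2 b ⟨hb, hpb⟩
    refine ⟨y ^ n, ?_, ?_⟩
    · intro q hq hqy
      refine hy q hq ((gSupp_map h y (y ^ n)).2 ?_ q hq hqy)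
      intro q hq hqy
      rw [PNat.pow_coe] at hqy
      exact hq.dvd_of_dvd_pow hqy
    · have e1 : (w : ℕ) ≤ (y : ℕ) ^ n := by
        rw [hn]; exact Nat.pow_le_pow_left (by rw [hk]; exact Nat.le_add_right _ _) _
      have e2 : (w : ℕ) ≡ (y : ℕ) ^ n [MOD b] := by
        rw [hn]
        refine Nat.ModEq.pow _ ?_
        rw [hk]; unfold Nat.ModEq; simp
      obtain ⟨j, hj⟩ := (Nat.modEq_iff_dvd' e1).1 e2
      exact ⟨j, by rw [PNat.pow_coe]; omega⟩
  have c4 : h w ∈ closure D' := by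
    rw [← h.preimage_closure] at c3; exact c3
  rw [mem_closure_iff_nhds_basis (gBasis _)] at c4
  obtain ⟨y, hy, k, hk⟩ := c4 m ⟨hm0, hcop⟩
  have e1 := gMod_of_primes m y y.ne_zero hy
  have e2 : (y : ℕ) ≡ r [MOD m] := by rw [hk]; unfold Nat.ModEq; simp [hr]
  have e3 := (Nat.modEq_iff_dvd' (by omega)).1 (e1.symm.trans e2)
  have e4 := Nat.le_of_dvd (by omega) e3
  omega

theorem golomb_homeo_primes (h : ℕ+ ≃ₜ ℕ+) :
    (h '' {p : ℕ+ | (p : ℕ).Prime} = {p : ℕ+ | (p : ℕ).Prime}) ∧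
    (∀ x : ℕ+, {p : ℕ+ | (p : ℕ).Prime ∧ (p : ℕ) ∣ ((h x : ℕ+) : ℕ)} =
      h '' {p : ℕ+ | (p : ℕ).Prime ∧ (p : ℕ) ∣ (x : ℕ)}) := by
  have hiff : ∀ p : ℕ+, ((h p : ℕ+) : ℕ).Prime ↔ (p : ℕ).Prime := fun p =>
    ⟨fun H => by simpa using gPrime h.symm _ H, gPrime h p⟩
  have key : ∀ p x : ℕ+, (p : ℕ).Prime → (gSupp p x ↔ (p : ℕ) ∣ (x : ℕ)) := fun p x hp =>
    ⟨fun H => H p hp dvd_rfl, fun H q hq hqp => hqp.trans H⟩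
  constructor
  · ext q
    obtain ⟨p, rfl⟩ := h.surjective q
    simp [hiff]
  · intro x
    ext q
    obtain ⟨p, rfl⟩ := h.surjective q
    simp only [Set.mem_setOf_eq, h.injective.mem_set_image, hiff]
    refine and_congr_right fun hp => ?_
    rw [← key _ _ ((hiff p).2 hp), gSupp_map, key _ _ hp]
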